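/- Let n ≥ 3, p ≥ 2 real, q = p/(p−1), and let f be a locally Lipschitz function defined in a neighbourhood of S_p^{n−1} with |∇f|_q ≤ 1 wherever the gradient exists (equivalently, f is 1-Lipschitz with respect to the ℓ_p-norm). Then for every t ≥ 0, μ_{p,n}( |f − ∫ f dμ_{p,n}| ≥ t ) ≤ 2 exp( − ((q−1)^p / (3^{p−1} · 4^p · q)) n t^p ). -/

import Mathlib

open MeasureTheory Real

/-- The `ℓ_p`-norm on `ℝⁿ`. -/
noncomputable def lpNorm (p : ℝ) {n : ℕ} (x : Fin n → ℝ) : ℝ :=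
  (∑ i, |x i| ^ p) ^ (1 / p)

/-- The cone probability measure `μ_{p,n}` on the `ℓ_p`-sphere: the pushforward of the
normalized Lebesgue measure on the `ℓ_p`-unit ball under radial projection `x ↦ x/|x|_p`. -/
noncomputable def coneMeasure (p : ℝ) (n : ℕ) : Measure (Fin n → ℝ) :=
  Measure.map (fun x => (lpNorm p x)⁻¹ • x)
    ((volume {x : Fin n → ℝ | lpNorm p x ≤ 1})⁻¹ •
      volume.restrict {x : Fin n → ℝ | lpNorm p x ≤ 1})

/-- The entropy functional `Ent_μ(g) = ∫ g log g dμ - (∫ g dμ) log(∫ g dμ)`. -/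
noncomputable def entropy {α : Type*} [MeasurableSpace α] (μ : Measure α) (g : α → ℝ) : ℝ :=
  (∫ x, g x * Real.log (g x) ∂μ) - (∫ x, g x ∂μ) * Real.log (∫ x, g x ∂μ)


/-- One-dimensional Brunn–Minkowski, compact version. -/
lemma bm_compact (K L C : Set ℝ) (hK : IsCompact K) (hL : IsCompact L)
    (hK0 : K.Nonempty) (hL0 : L.Nonempty)
    (h : ∀ x ∈ K, ∀ y ∈ L, (x + y) / 2 ∈ C) :
    volume K + volume L ≤ 2 * volume C := by
  obtain ⟨k, hk⟩ := hK.exists_isGreatest hK0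
  obtain ⟨l, hl⟩ := hL.exists_isLeast hL0
  have key : ∀ (a : ℝ) (S : Set ℝ), volume ((fun x => (x + a) / 2) ⁻¹' S) = 2 * volume S := by
    intro a S
    have : (fun x : ℝ => (x + a) / 2) ⁻¹' S
        = (fun x => x + a) ⁻¹' ((fun x => (2:ℝ)⁻¹ * x) ⁻¹' S) := by
      ext x; simp [div_eq_inv_mul]
    rw [this, measure_preimage_add_right, Real.volume_preimage_mul_left (by norm_num)]
    simp
  set c := (k + l) / 2
  have h1 : volume K ≤ 2 * volume (C ∩ Set.Iic c) := by
    rw [← key l]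
    refine measure_mono fun x hx => ⟨h x hx l hl.1, ?_⟩
    have := hk.2 hx
    simp only [Set.mem_Iic, c]; linarith
  have h2 : volume L ≤ 2 * volume (C ∩ Set.Ici c) := by
    rw [← key k]
    refine measure_mono fun x hx => ⟨?_, ?_⟩
    · have := h k hk.1 x hx
      rwa [add_comm] at this
    · have := hl.2 hx
      simp only [Set.mem_Ici, c]; linarith
  have h3 : volume (C ∩ Set.Ici c) = volume (C \ Set.Iic c) := by
    rw [Set.sdiff_eq, Set.compl_Iic]
    apply measure_congr
    exact (Filter.EventuallyEq.refl _ _).inter Ioi_ae_eq_Ici.symm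
  calc volume K + volume L ≤ 2 * volume (C ∩ Set.Iic c) + 2 * volume (C ∩ Set.Ici c) := by gcongr
    _ = 2 * volume C := by
      rw [← mul_add, h3, measure_inter_add_sdiff _ measurableSet_Iic]

/-- One-dimensional Brunn–Minkowski. -/
lemma bm_one (A B C : Set ℝ) (hA : MeasurableSet A) (hB : MeasurableSet B)
    (hA0 : A.Nonempty) (hB0 : B.Nonempty)
    (h : ∀ x ∈ A, ∀ y ∈ B, (x + y) / 2 ∈ C) :
    volume A + volume B ≤ 2 * volume C := by
  obtain ⟨a, ha⟩ := hA0
  obtain ⟨b, hb⟩ := hB0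
  rw [hA.measure_eq_iSup_isCompact, hB.measure_eq_iSup_isCompact]
  refine ENNReal.iSup_add_iSup_le fun K L => ?_
  have main : ∀ K L : Set ℝ, K ⊆ A → IsCompact K → L ⊆ B → IsCompact L →
      volume K + volume L ≤ 2 * volume C := by
    intro K L hKA hK hLB hL
    refine le_trans ?_ (bm_compact (insert a K) (insert b L) C (hK.insert a) (hL.insert b)
      ⟨a, by simp⟩ ⟨b, by simp⟩ ?_)
    · gcongr <;> exact Set.subset_insert _ _
    · intro x hx y hy
      exact h x (Set.insert_subset ha hKA hx) y (Set.insert_subset hb hLB hy)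
  by_cases h1 : K ⊆ A ∧ IsCompact K
  · by_cases h2 : L ⊆ B ∧ IsCompact L
    · simpa [h1, h2] using main K L h1.1 h1.2 h2.1 h2.2
    · have : (⨆ (_ : L ⊆ B), ⨆ (_ : IsCompact L), volume L) = 0 := by
        simp only [ENNReal.iSup_eq_zero]; tauto
      rw [this]
      simpa [h1] using main K ∅ h1.1 h1.2 (by simp) (by simp)
  · have e1 : (⨆ (_ : K ⊆ A), ⨆ (_ : IsCompact K), volume K) = 0 := by
      simp only [ENNReal.iSup_eq_zero]; tauto
    rw [e1]
    by_cases h2 : L ⊆ B ∧ IsCompact L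
    · simpa [h2] using main ∅ L (by simp) (by simp) h2.1 h2.2
    · have : (⨆ (_ : L ⊆ B), ⨆ (_ : IsCompact L), volume L) = 0 := by
        simp only [ENNReal.iSup_eq_zero]; tauto
      rw [this]; simp

lemma pl_normalized (f g h : ℝ → ℝ) (hf : Measurable f) (hg : Measurable g) (hh : Measurable h)
    (f0 : ∀ x, 0 ≤ f x) (g0 : ∀ x, 0 ≤ g x) (h0 : ∀ x, 0 ≤ h x)
    (f1 : ∀ x, f x ≤ 1) (g1 : ∀ x, g x ≤ 1)
    (fs : ∀ s < 1, ∃ x, s < f x) (gs : ∀ s < 1, ∃ x, s < g x)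
    (H : ∀ x y, f x * g y ≤ h ((x + y) / 2) ^ 2) :
    (∫⁻ x, ENNReal.ofReal (f x)) + (∫⁻ x, ENNReal.ofReal (g x))
      ≤ 2 * ∫⁻ x, ENNReal.ofReal (h x) := by
  rw [lintegral_eq_lintegral_meas_lt _ (.of_forall f0) hf.aemeasurable,
    lintegral_eq_lintegral_meas_lt _ (.of_forall g0) hg.aemeasurable,
    lintegral_eq_lintegral_meas_lt _ (.of_forall h0) hh.aemeasurable,
    ← lintegral_const_mul' _ _ (by simp)]
  rw [← lintegral_add_left]
  · refine setLIntegral_mono' measurableSet_Ioi fun s hs => ?_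
    have hs : 0 < s := hs
    by_cases hs1 : s < 1
    · refine bm_one _ _ _ (measurableSet_lt measurable_const hf)
        (measurableSet_lt measurable_const hg) (fs s hs1) (gs s hs1) ?_
      intro x hx y hy
      simp only [Set.mem_ofPred_eq] at *
      have := H x y
      have : s * s < h ((x+y)/2)^2 := lt_of_lt_of_le (mul_lt_mul'' hx hy hs.le hs.le) this
      by_contra hc
      push Not at hc
      nlinarith [h0 ((x+y)/2)]
    · have e1 : {a | s < f a} = ∅ := by
        ext x; simp; linarith [f1 x]
      have e2 : {a | s < g a} = ∅ := by
        ext x; simp; linarith [g1 x]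
      simp [e1, e2]
  · exact Antitone.measurable fun a b hab => measure_mono fun x hx => lt_of_le_of_lt hab hx

lemma amgm_ennreal (a b c : ENNReal) (h : a + b ≤ 2 * c) : a * b ≤ c ^ 2 := by
  by_cases hc : c = ⊤
  · simp [hc]
  have hab : a + b ≠ ⊤ := ne_top_of_le_ne_top (ENNReal.mul_ne_top (by simp) hc) h
  rw [ENNReal.add_ne_top] at hab
  lift a to NNReal using hab.1
  lift b to NNReal using hab.2
  lift c to NNReal using hc
  norm_cast at *
  have h' : (a:ℝ) + b ≤ 2 * c := by exact_mod_cast h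
  have : (a:ℝ) * b ≤ c ^ 2 := by nlinarith [sq_nonneg ((a:ℝ) - b), a.2, b.2, c.2]
  exact_mod_cast this

lemma pl_bdd (f g h : ℝ → ENNReal) (hf : Measurable f) (hg : Measurable g) (hh : Measurable h)
    (fb : (⨆ x, f x) ≠ ⊤) (gb : (⨆ x, g x) ≠ ⊤)
    (H : ∀ x y, f x * g y ≤ h ((x + y) / 2) ^ 2) :
    (∫⁻ x, f x) * (∫⁻ x, g x) ≤ (∫⁻ x, h x) ^ 2 := by
  set F := ⨆ x, f x with hF
  set G := ⨆ x, g x with hG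
  by_cases F0 : F = 0
  · have : ∀ x, f x = 0 := by simpa [hF] using F0
    simp [this]
  by_cases G0 : G = 0
  · have : ∀ x, g x = 0 := by simpa [hG] using G0
    simp [this]
  set W := (F * G) ^ (1/2 : ℝ) with hW
  have W2 : W ^ 2 = F * G := by
    rw [hW, ← ENNReal.rpow_natCast, ← ENNReal.rpow_mul]; norm_num
  have W0 : W ≠ 0 := by
    intro hw; rw [hw] at W2; simp at W2
    rcases W2 with h | h
    · exact F0 h
    · exact G0 h
  have Wt : W ≠ ⊤ := by
    intro hw; rw [hw] at W2; simp at W2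
    exact ENNReal.mul_ne_top fb gb W2.symm
  have fle : ∀ x, f x / F ≤ 1 := fun x => ENNReal.div_le_of_le_mul (by simpa using le_iSup f x)
  have gle : ∀ x, g x / G ≤ 1 := fun x => ENNReal.div_le_of_le_mul (by simpa using le_iSup g x)
  have hle : ∀ x, min (h x / W) 1 ≤ 1 := fun x => min_le_right _ _
  have t1 : ∀ {a : ENNReal}, a ≤ 1 → a ≠ ⊤ := fun h => ne_top_of_le_ne_top (by simp) h
  have sup_aux : ∀ (u : ℝ → ENNReal) (U : ENNReal), U = (⨆ x, u x) → U ≠ 0 → U ≠ ⊤ →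
      (∀ x, u x / U ≤ 1) → ∀ s < (1:ℝ), ∃ x, s < (u x / U).toReal := by
    intro u U hU hU0 hUt ule s hs
    by_contra hc
    push Not at hc
    have : U ≤ ENNReal.ofReal s * U := by
      conv_lhs => rw [hU]
      refine iSup_le fun x => ?_
      rw [← ENNReal.div_le_iff hU0 hUt]
      rw [← ENNReal.ofReal_toReal (t1 (ule x))]
      exact ENNReal.ofReal_le_ofReal (hc x)
    have h2 : ENNReal.ofReal s * U < 1 * U := by
      rw [ENNReal.mul_lt_mul_iff_left hU0 hUt]
      simpa using hs
    rw [one_mul] at h2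
    exact absurd this (not_le.2 h2)
  have key := pl_normalized (fun x => (f x / F).toReal) (fun x => (g x / G).toReal)
    (fun x => (min (h x / W) 1).toReal) (hf.div_const _).ennreal_toReal
    (hg.div_const _).ennreal_toReal ((hh.div_const _).min measurable_const).ennreal_toReal
    (fun _ => ENNReal.toReal_nonneg) (fun _ => ENNReal.toReal_nonneg)
    (fun _ => ENNReal.toReal_nonneg)
    (fun x => ENNReal.toReal_le_of_le_ofReal (by simp) (by simpa using fle x))
    (fun x => ENNReal.toReal_le_of_le_ofReal (by simp) (by simpa using gle x))
    (sup_aux f F hF F0 fb fle) (sup_aux g G hG G0 gb gle) (by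
      intro x y
      rw [← ENNReal.toReal_mul, ← ENNReal.toReal_pow]
      refine ENNReal.toReal_mono (ENNReal.pow_ne_top (t1 (hle _))) ?_
      rcases le_total (h ((x+y)/2) / W) 1 with hc | hc
      · rw [min_eq_left hc, ENNReal.div_eq_inv_mul, ENNReal.div_eq_inv_mul, ENNReal.div_eq_inv_mul,
          mul_pow, ← ENNReal.inv_pow, W2, ENNReal.mul_inv (.inl F0) (.inl fb)]
        calc F⁻¹ * f x * (G⁻¹ * g y) = F⁻¹ * G⁻¹ * (f x * g y) := by ring
          _ ≤ _ := by gcongr; exact H x y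
      · rw [min_eq_right hc]
        calc f x / F * (g y / G) ≤ 1 * 1 := mul_le_mul' (fle x) (gle y)
          _ = 1 ^ 2 := by simp)
  simp only [ENNReal.ofReal_toReal (t1 (fle _)), ENNReal.ofReal_toReal (t1 (gle _)),
    ENNReal.ofReal_toReal (t1 (hle _))] at key
  have key2 := amgm_ennreal _ _ _ key
  have hmono : ∫⁻ x, min (h x / W) 1 ≤ ∫⁻ x, h x / W := lintegral_mono fun x => min_le_left _ _
  have key3 : (∫⁻ x, f x / F) * (∫⁻ x, g x / G) ≤ (∫⁻ x, h x / W) ^ 2 :=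
    key2.trans (by gcongr)
  simp only [ENNReal.div_eq_inv_mul] at key3
  rw [lintegral_const_mul _ hf, lintegral_const_mul _ hg, lintegral_const_mul _ hh, mul_pow,
    ← ENNReal.inv_pow, W2] at key3
  have FG0 : F * G ≠ 0 := mul_ne_zero F0 G0
  have FGt : F * G ≠ ⊤ := ENNReal.mul_ne_top fb gb
  have key4 : F * G * ((F⁻¹ * ∫⁻ x, f x) * (G⁻¹ * ∫⁻ x, g x))
      ≤ F * G * ((F * G)⁻¹ * (∫⁻ x, h x) ^ 2) := by gcongr
  rw [← mul_assoc (F*G) (F*G)⁻¹, ENNReal.mul_inv_cancel FG0 FGt, one_mul] at key4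
  refine le_trans (le_of_eq ?_) key4
  calc (∫⁻ x, f x) * (∫⁻ x, g x) = (F * F⁻¹) * (G * G⁻¹) * ((∫⁻ x, f x) * (∫⁻ x, g x)) := by
        rw [ENNReal.mul_inv_cancel F0 fb, ENNReal.mul_inv_cancel G0 gb]; simp
    _ = _ := by ring

/-- One-dimensional Prékopa–Leindler inequality (midpoint version). -/
lemma pl_one (f g h : ℝ → ENNReal) (hf : Measurable f) (hg : Measurable g) (hh : Measurable h)
    (H : ∀ x y, f x * g y ≤ h ((x + y) / 2) ^ 2) :
    (∫⁻ x, f x) * (∫⁻ x, g x) ≤ (∫⁻ x, h x) ^ 2 := by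
  have aux : ∀ u : ℝ → ENNReal, Measurable u →
      ∫⁻ x, u x = ⨆ k : ℕ, ∫⁻ x, min (u x) k := by
    intro u hu
    rw [← lintegral_iSup (fun k => hu.min measurable_const)]
    · congr 1; ext x
      rw [← inf_iSup_eq, ENNReal.iSup_natCast]; simp
    · intro a b hab x
      exact min_le_min le_rfl (by exact_mod_cast hab)
  rw [aux f hf, aux g hg, ENNReal.iSup_mul]
  refine iSup_le fun k => ?_
  rw [ENNReal.mul_iSup]
  refine iSup_le fun l => ?_
  refine pl_bdd _ _ h (hf.min measurable_const) (hg.min measurable_const) hh ?_ ?_ ?_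
  · exact ne_top_of_le_ne_top (ENNReal.natCast_ne_top k) (iSup_le fun x => min_le_right _ _)
  · exact ne_top_of_le_ne_top (ENNReal.natCast_ne_top l) (iSup_le fun x => min_le_right _ _)
  · intro x y
    exact (mul_le_mul' (min_le_left _ _) (min_le_left _ _)).trans (H x y)

lemma piFin_symm_eq {n : ℕ} (p : ℝ × (Fin n → ℝ)) :
    (MeasurableEquiv.piFinSuccAbove (fun _ : Fin (n+1) => ℝ) 0).symm p
      = (Fin.cons p.1 p.2 : Fin (n+1) → ℝ) := by
  simp [MeasurableEquiv.piFinSuccAbove_symm_apply, Fin.insertNthEquiv]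

lemma lintegral_cons {n : ℕ} (f : (Fin (n+1) → ℝ) → ENNReal) (hf : Measurable f) :
    ∫⁻ x, f x = ∫⁻ a : ℝ, ∫⁻ x : Fin n → ℝ, f (Fin.cons a x) := by
  have mp := (volume_preserving_piFinSuccAbove (fun _ : Fin (n+1) => ℝ) 0).symm
  rw [← mp.lintegral_comp hf]
  rw [Measure.volume_eq_prod, lintegral_prod]
  · simp only [piFin_symm_eq]
  · exact (hf.comp (MeasurableEquiv.measurable _)).aemeasurable

/-- Prékopa–Leindler inequality (midpoint version). -/
lemma pl_multi (n : ℕ) : ∀ (f g h : (Fin n → ℝ) → ENNReal), Measurable f → Measurable g →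
    Measurable h → (∀ x y, f x * g y ≤ h ((1/2 : ℝ) • (x + y)) ^ 2) →
    (∫⁻ x, f x) * (∫⁻ x, g x) ≤ (∫⁻ x, h x) ^ 2 := by
  induction n with
  | zero =>
    intro f g h hf hg hh H
    rw [Measure.volume_pi_eq_dirac 0, lintegral_dirac, lintegral_dirac, lintegral_dirac]
    simpa using H 0 0
  | succ n ih =>
    intro f g h hf hg hh H
    have hcons : Measurable (fun p : ℝ × (Fin n → ℝ) => (Fin.cons p.1 p.2 : Fin (n+1) → ℝ)) := by
      have := (MeasurableEquiv.piFinSuccAbove (fun _ : Fin (n+1) => ℝ) 0).symm.measurable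
      convert this using 2 with p
      exact (piFin_symm_eq p).symm
    rw [lintegral_cons f hf, lintegral_cons g hg, lintegral_cons h hh]
    refine pl_one _ _ _ (hf.comp hcons).lintegral_prod_right' (hg.comp hcons).lintegral_prod_right'
      (hh.comp hcons).lintegral_prod_right' ?_
    intro a b
    have hc : ∀ a : ℝ, Measurable (fun x : Fin n → ℝ => (Fin.cons a x : Fin (n+1) → ℝ)) :=
      fun a => hcons.comp measurable_prodMk_left
    refine ih _ _ _ (hf.comp (hc a)) (hg.comp (hc b)) (hh.comp (hc _)) ?_
    intro x y
    refine (H _ _).trans (le_of_eq ?_)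
    congr 2
    ext i
    refine Fin.cases ?_ (fun j => ?_) i
    · simp; ring
    · simp; ring

lemma bm_mult {n : ℕ} (A B C : Set (Fin n → ℝ)) (hA : MeasurableSet A) (hB : MeasurableSet B)
    (hC : MeasurableSet C) (h : ∀ x ∈ A, ∀ y ∈ B, (1/2 : ℝ) • (x + y) ∈ C) :
    volume A * volume B ≤ volume C ^ 2 := by
  have := pl_multi n (A.indicator 1) (B.indicator 1) (C.indicator 1)
    (measurable_one.indicator hA) (measurable_one.indicator hB) (measurable_one.indicator hC) (by
      intro x y
      by_cases hx : x ∈ A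
      · by_cases hy : y ∈ B
        · have := h x hx y hy
          rw [Set.indicator_of_mem hx, Set.indicator_of_mem hy, Set.indicator_of_mem this]; simp
        · simp [hy]
      · simp [hx])
  rwa [lintegral_indicator_one hA, lintegral_indicator_one hB, lintegral_indicator_one hC] at this

section norm
variable {p : ℝ} {n : ℕ}

lemma lpn_nonneg (x : Fin n → ℝ) : 0 ≤ lpNorm p x := by
  unfold _root_.lpNorm; positivity

lemma lpn_rpow (hp : 2 ≤ p) (x : Fin n → ℝ) : lpNorm p x ^ p = ∑ i, |x i| ^ p := by
  unfold _root_.lpNorm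
  rw [← Real.rpow_mul (by positivity), one_div, inv_mul_cancel₀ (by linarith), Real.rpow_one]

lemma lpn_smul (hp : 2 ≤ p) (c : ℝ) (x : Fin n → ℝ) : lpNorm p (c • x) = |c| * lpNorm p x := by
  unfold _root_.lpNorm
  have : ∀ i, |(c • x) i| ^ p = |c| ^ p * |x i| ^ p := by
    intro i
    rw [Pi.smul_apply, smul_eq_mul, abs_mul, Real.mul_rpow (abs_nonneg _) (abs_nonneg _)]
  simp only [this]
  rw [← Finset.mul_sum, Real.mul_rpow (by positivity) (by positivity),
    ← Real.rpow_mul (abs_nonneg _), mul_one_div_cancel (by linarith), Real.rpow_one]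

lemma lpn_add_le (hp : 2 ≤ p) (x y : Fin n → ℝ) :
    lpNorm p (x + y) ≤ lpNorm p x + lpNorm p y :=
  Real.Lp_add_le _ _ _ (by linarith)

lemma lpn_zero (hp : 2 ≤ p) : lpNorm p (0 : Fin n → ℝ) = 0 := by
  have := lpn_smul (n := n) hp 0 0
  simpa using this

lemma lpn_pos (hp : 2 ≤ p) (x : Fin n → ℝ) (hx : x ≠ 0) : 0 < lpNorm p x := by
  obtain ⟨i, hi⟩ := Function.ne_iff.1 hx
  unfold _root_.lpNorm
  refine Real.rpow_pos_of_pos (Finset.sum_pos' (fun i _ => by positivity) ⟨i, Finset.mem_univ _, ?_⟩) _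
  exact Real.rpow_pos_of_pos (abs_pos.2 hi) _

lemma lpn_sub_comm (hp : 2 ≤ p) (x y : Fin n → ℝ) : lpNorm p (x - y) = lpNorm p (y - x) := by
  have := lpn_smul hp (-1) (y - x)
  simpa using this

lemma lpn_cont (hp : 2 ≤ p) : Continuous (fun x : Fin n → ℝ => lpNorm p x) := by
  unfold _root_.lpNorm
  refine Continuous.rpow_const (continuous_finsetSum _ fun i _ => ?_)
    (fun x => .inr (by positivity))
  exact (continuous_apply i).abs.rpow_const fun x => .inr (by linarith)

lemma clarkson_scalar (hp : 2 ≤ p) (a b : ℝ) :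
    |(a + b) / 2| ^ p + |(a - b) / 2| ^ p ≤ (|a| ^ p + |b| ^ p) / 2 := by
  have hsq : ∀ u : ℝ, |u| ^ p = (u ^ 2) ^ (p / 2) := by
    intro u
    rw [← sq_abs, ← Real.rpow_natCast, ← Real.rpow_mul (abs_nonneg _)]
    congr 1; push_cast; ring
  rw [hsq, hsq, hsq, hsq]
  have h1 := Real.add_rpow_le_rpow_add (sq_nonneg ((a+b)/2)) (sq_nonneg ((a-b)/2))
    (p := p/2) (by linarith)
  have h2 := (convexOn_rpow (p := p/2) (by linarith)).2 (Set.mem_Ici.2 (sq_nonneg a))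
    (Set.mem_Ici.2 (sq_nonneg b)) (show (0:ℝ) ≤ 1/2 by norm_num) (show (0:ℝ) ≤ 1/2 by norm_num)
    (by norm_num)
  simp only [smul_eq_mul] at h2
  have h3 : ((a+b)/2)^2 + ((a-b)/2)^2 = 1/2 * a^2 + 1/2 * b^2 := by ring
  rw [h3] at h1
  linarith

lemma clarkson (hp : 2 ≤ p) (x y : Fin n → ℝ) :
    lpNorm p ((1/2 : ℝ) • (x + y)) ^ p + lpNorm p ((1/2 : ℝ) • (x - y)) ^ p
      ≤ (lpNorm p x ^ p + lpNorm p y ^ p) / 2 := by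
  rw [lpn_rpow hp, lpn_rpow hp, lpn_rpow hp, lpn_rpow hp, ← Finset.sum_add_distrib,
    ← Finset.sum_add_distrib, Finset.sum_div]
  refine Finset.sum_le_sum fun i _ => ?_
  have := clarkson_scalar hp (x i) (y i)
  simpa [div_eq_inv_mul] using this

lemma sep_aux (hp : 2 ≤ p) (x y : Fin n → ℝ) (hx : x ≠ 0) (hy : y ≠ 0) (t : ℝ)
    (ht : t ≤ lpNorm p ((lpNorm p x)⁻¹ • x - (lpNorm p y)⁻¹ • y)) :
    lpNorm p x * t ≤ 2 * lpNorm p (x - y) := by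
  have hr := lpn_pos hp x hx
  have hs := lpn_pos hp y hy
  set r := lpNorm p x with hr'
  set s := lpNorm p y with hs'
  have e1 : r * lpNorm p (r⁻¹ • x - s⁻¹ • y) = lpNorm p ((x - y) + (1 - r * s⁻¹) • y) := by
    have := lpn_smul hp r (r⁻¹ • x - s⁻¹ • y)
    rw [abs_of_pos hr] at this
    rw [← this]
    congr 1
    rw [smul_sub, smul_smul, smul_smul, mul_inv_cancel₀ hr.ne', one_smul, sub_smul, one_smul]
    abel
  have e2 : lpNorm p ((1 - r * s⁻¹) • y) = |s - r| := by
    rw [lpn_smul hp, ← hs']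
    have e : s - r = (1 - r * s⁻¹) * s := by field_simp
    rw [e, abs_mul, abs_of_pos hs]
  have e3 : |s - r| ≤ lpNorm p (x - y) := by
    have h1 := lpn_add_le hp (x - y) y
    have h2 := lpn_add_le hp (y - x) x
    rw [sub_add_cancel] at h1 h2
    rw [lpn_sub_comm hp y x] at h2
    rw [abs_le]; constructor <;> linarith
  have e4 := lpn_add_le hp (x - y) ((1 - r * s⁻¹) • y)
  have e5 : r * t ≤ r * lpNorm p (r⁻¹ • x - s⁻¹ • y) := by gcongr
  linarith

lemma sep_mid (hp : 2 ≤ p) (x y : Fin n → ℝ) (hx : x ≠ 0) (hy : y ≠ 0)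
    (hx1 : lpNorm p x ≤ 1) (hy1 : lpNorm p y ≤ 1) (t : ℝ) (t0 : 0 ≤ t)
    (ht : t ≤ lpNorm p ((lpNorm p x)⁻¹ • x - (lpNorm p y)⁻¹ • y)) :
    lpNorm p ((1/2 : ℝ) • (x + y)) ≤ Real.exp (-(t/4)^p / p) := by
  have h1 := sep_aux hp x y hx hy t ht
  have h2 := sep_aux hp y x hy hx t (by rwa [lpn_sub_comm hp])
  rw [lpn_sub_comm hp] at h2
  have hc := clarkson hp x y
  have hr := lpn_pos hp x hx
  have hs := lpn_pos hp y hy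
  set r := lpNorm p x
  set s := lpNorm p y
  have hd : lpNorm p ((1/2 : ℝ) • (x - y)) = lpNorm p (x - y) / 2 := by
    rw [lpn_smul hp, abs_of_pos (by norm_num)]; ring
  rw [hd] at hc
  have h1' : (t/4)^p * r^p ≤ (lpNorm p (x - y) / 2)^p := by
    rw [← Real.mul_rpow (by positivity) hr.le]
    exact Real.rpow_le_rpow (by positivity) (by linarith) (by linarith)
  have h2' : (t/4)^p * s^p ≤ (lpNorm p (x - y) / 2)^p := by
    rw [← Real.mul_rpow (by positivity) hs.le]
    exact Real.rpow_le_rpow (by positivity) (by linarith) (by linarith)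
  have hr1 : r ^ p ≤ 1 := Real.rpow_le_one hr.le hx1 (by linarith)
  have hs1 : s ^ p ≤ 1 := Real.rpow_le_one hs.le hy1 (by linarith)
  have hr0 : 0 ≤ r ^ p := by positivity
  have hs0 : 0 ≤ s ^ p := by positivity
  have he := Real.add_one_le_exp (-(t/4)^p)
  have he0 := Real.exp_pos (-(t/4)^p)
  have fin : lpNorm p ((1/2 : ℝ) • (x + y)) ^ p ≤ Real.exp (-(t/4)^p) := by
    have : lpNorm p ((1/2 : ℝ) • (x + y)) ^ p ≤ (1 - (t/4)^p) * ((r^p + s^p)/2) := by nlinarith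
    nlinarith
  have := Real.rpow_le_rpow (by have := lpn_nonneg (p := p) ((1/2 : ℝ) • (x + y)); positivity) fin
    (z := 1/p) (by positivity)
  rw [← Real.rpow_mul (lpn_nonneg _), mul_one_div_cancel (by linarith), Real.rpow_one,
    ← Real.exp_mul] at this
  rwa [mul_one_div] at this

end norm

section cone
variable {p : ℝ} {n : ℕ}

lemma ball_vol (hp : 2 ≤ p) (hn : 3 ≤ n) : ∃ V : ENNReal, V ≠ 0 ∧ V ≠ ⊤ ∧
    ∀ r : ℝ, volume {x : Fin n → ℝ | lpNorm p x ≤ r} = ENNReal.ofReal r ^ n * V := by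
  have : Nonempty (Fin n) := ⟨⟨0, by omega⟩⟩
  refine ⟨ENNReal.ofReal ((2 * Real.Gamma (1 / p + 1)) ^ n / Real.Gamma (n / p + 1)), ?_,
    ENNReal.ofReal_ne_top, fun r => ?_⟩
  rotate_left
  · have := volume_sum_rpow_le (Fin n) (p := p) (by linarith) r
    rw [Fintype.card_fin] at this
    exact this
  · rw [Ne, ENNReal.ofReal_eq_zero, not_le]
    have h1 : 0 < Real.Gamma (1 / p + 1) := Real.Gamma_pos_of_pos (by positivity)
    have h2 : 0 < Real.Gamma (n / p + 1) := Real.Gamma_pos_of_pos (by positivity)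
    positivity

lemma proj_meas (hp : 2 ≤ p) : Measurable (fun x : Fin n → ℝ => (lpNorm p x)⁻¹ • x) :=
  (lpn_cont hp).measurable.inv.smul measurable_id

lemma ball_meas (hp : 2 ≤ p) (r : ℝ) : MeasurableSet {x : Fin n → ℝ | lpNorm p x ≤ r} :=
  measurableSet_le (lpn_cont hp).measurable measurable_const

lemma cone_apply (hp : 2 ≤ p) (A : Set (Fin n → ℝ)) (hA : MeasurableSet A) :
    coneMeasure p n A = (volume {x : Fin n → ℝ | lpNorm p x ≤ 1})⁻¹ *
      volume ((fun x => (lpNorm p x)⁻¹ • x) ⁻¹' A ∩ {x : Fin n → ℝ | lpNorm p x ≤ 1}) := by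
  unfold coneMeasure
  rw [Measure.map_apply (proj_meas hp) hA, Measure.smul_apply,
    Measure.restrict_apply (proj_meas hp hA), smul_eq_mul]

lemma cone_prob (hp : 2 ≤ p) (hn : 3 ≤ n) : IsProbabilityMeasure (coneMeasure p n) := by
  obtain ⟨V, V0, Vt, hV⟩ := ball_vol (p := p) hp hn
  constructor
  rw [cone_apply hp _ MeasurableSet.univ, Set.preimage_univ, Set.univ_inter, hV]
  simp [ENNReal.inv_mul_cancel V0 Vt]

lemma cone_ae (hp : 2 ≤ p) : ∀ᵐ x ∂(coneMeasure p n), lpNorm p x ≤ 1 := by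
  unfold coneMeasure
  rw [ae_map_iff (proj_meas hp).aemeasurable (ball_meas hp 1)]
  refine Filter.Eventually.of_forall fun x => ?_
  rw [lpn_smul hp, abs_inv, abs_of_nonneg (lpn_nonneg _)]
  exact inv_mul_le_one

lemma cone_sep (hp : 2 ≤ p) (hn : 3 ≤ n) (A B : Set (Fin n → ℝ)) (hA : MeasurableSet A)
    (hB : MeasurableSet B) (t : ℝ) (t0 : 0 ≤ t)
    (hAB : ∀ a ∈ A, ∀ b ∈ B, t ≤ lpNorm p (a - b)) :
    coneMeasure p n A * coneMeasure p n B
      ≤ ENNReal.ofReal (Real.exp (-(2 * n / (p * 4 ^ p)) * t ^ p)) := by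
  have : Nonempty (Fin n) := ⟨⟨0, by omega⟩⟩
  obtain ⟨V, V0, Vt, hV⟩ := ball_vol (p := p) hp hn
  set pr : (Fin n → ℝ) → (Fin n → ℝ) := fun x => (lpNorm p x)⁻¹ • x with hpr
  set D := {x : Fin n → ℝ | lpNorm p x ≤ 1} with hD
  have nul : ∀ S : Set (Fin n → ℝ), volume (S \ {0}) = volume S := fun S =>
    measure_sdiff_null (by simp)
  have mS : ∀ S, MeasurableSet S → MeasurableSet ((pr ⁻¹' S ∩ D) \ {0}) := fun S hS =>
    ((proj_meas hp hS).inter (ball_meas hp 1)).diff (measurableSet_singleton 0)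
  have key := bm_mult ((pr ⁻¹' A ∩ D) \ {0}) ((pr ⁻¹' B ∩ D) \ {0})
    {x | lpNorm p x ≤ Real.exp (-(t/4)^p / p)} (mS A hA) (mS B hB) (ball_meas hp _) (by
      rintro x ⟨⟨hxA, hxD⟩, hx0⟩ y ⟨⟨hyB, hyD⟩, hy0⟩
      exact sep_mid hp x y hx0 hy0 hxD hyD t t0 (hAB _ hxA _ hyB))
  rw [nul, nul, hV] at key
  have hDV : volume D = V := by rw [hD, hV]; simp
  rw [cone_apply hp A hA, cone_apply hp B hB, ← hD, hDV]
  calc V⁻¹ * volume (pr ⁻¹' A ∩ D) * (V⁻¹ * volume (pr ⁻¹' B ∩ D))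
      = V⁻¹ * V⁻¹ * (volume (pr ⁻¹' A ∩ D) * volume (pr ⁻¹' B ∩ D)) := by ring
    _ ≤ V⁻¹ * V⁻¹ * (ENNReal.ofReal (Real.exp (-(t/4)^p / p)) ^ n * V) ^ 2 := by gcongr
    _ = (V⁻¹ * V) * (V⁻¹ * V) * (ENNReal.ofReal (Real.exp (-(t/4)^p / p)) ^ n) ^ 2 := by ring
    _ = ENNReal.ofReal (Real.exp (-(2 * n / (p * 4 ^ p)) * t ^ p)) := by
      rw [ENNReal.inv_mul_cancel V0 Vt, one_mul, one_mul, ← pow_mul,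
        ← ENNReal.ofReal_pow (Real.exp_pos _).le, ← Real.exp_nat_mul,
        Real.div_rpow t0 (by norm_num)]
      congr 2
      have : p ≠ 0 := by linarith
      have : (4:ℝ)^p ≠ 0 := by positivity
      push_cast
      field_simp

end cone

/-- Concentration around the mean from two-set concentration. -/
lemma mean_tail {α : Type*} [MeasurableSpace α] (μ : Measure α) [IsProbabilityMeasure μ]
    (X : α → ℝ) (hX : Measurable X) (hi : Integrable X μ) (p K : ℝ) (hp : 2 ≤ p) (hK : 0 < K)
    (H : ∀ u r : ℝ, 0 ≤ r → μ {x | u ≤ X x} * μ {x | X x ≤ u - r}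
      ≤ ENNReal.ofReal (Real.exp (-K * r ^ p)))
    (t : ℝ) (ht : K ^ (-1 / p) ≤ t) :
    μ {x | (∫ y, X y ∂μ) + t ≤ X x} ≤ ENNReal.ofReal (Real.exp (-K * (t - K ^ (-1/p)) ^ p)) := by
  set m := ∫ y, X y ∂μ with hm
  set b := K ^ (-1/p) with hb
  have b0 : 0 < b := Real.rpow_pos_of_pos hK _
  set a := μ.real {x | m + t ≤ X x} with ha
  have haE : μ {x | m + t ≤ X x} = ENNReal.ofReal a := by
    rw [ha, ofReal_measureReal]
  rw [haE]
  have an : 0 ≤ a := measureReal_nonneg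
  rcases an.eq_or_lt with a0 | a0
  · rw [← a0]; simp
  have a1 : a ≤ 1 := measureReal_le_one
  set r₀ := ((-Real.log a) / K) ^ (1/p) with hr₀
  have hl : 0 ≤ -Real.log a := by linarith [Real.log_nonpos a0.le a1]
  have r0 : 0 ≤ r₀ := by positivity
  have hr0p : K * r₀ ^ p = - Real.log a := by
    rw [hr₀, ← Real.rpow_mul (by positivity), one_div, inv_mul_cancel₀ (by linarith), Real.rpow_one]
    field_simp
  have hae : a = Real.exp (-K * r₀ ^ p) := by
    rw [neg_mul, hr0p, neg_neg, Real.exp_log a0]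
  -- tail bound for `X` below
  have tail : ∀ r, r₀ ≤ r → μ {x | X x ≤ m + t - r}
      ≤ ENNReal.ofReal (Real.exp (-K * (r - r₀) ^ p)) := by
    intro r hr
    have h1 := H (m + t) r (r0.trans hr)
    rw [haE] at h1
    have h2 : μ {x | X x ≤ m + t - r} ≤ ENNReal.ofReal (Real.exp (-K * r ^ p)) / ENNReal.ofReal a := by
      rw [ENNReal.le_div_iff_mul_le (.inl (by simpa using a0)) (.inl (by simp)), mul_comm]
      exact h1
    refine h2.trans ?_
    rw [← ENNReal.ofReal_div_of_pos a0]
    apply ENNReal.ofReal_le_ofReal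
    rw [hae, ← Real.exp_sub]
    apply Real.exp_le_exp.2
    have := Real.add_rpow_le_rpow_add (p := p) (sub_nonneg.2 hr) r0 (by linarith)
    rw [sub_add_cancel] at this
    nlinarith
  have hint := integral_exp_neg_mul_rpow (p := p) (b := K) (by linarith) hK
  have G0 : 0 < Real.Gamma (1/p + 1) := Real.Gamma_pos_of_pos (by positivity)
  have G1 : Real.Gamma (1/p + 1) ≤ 1 := by
    have h1p : 1/p ≤ 1 := by rw [div_le_one (by linarith)]; linarith
    have h0p : 0 ≤ 1/p := by positivity
    have := Real.convexOn_Gamma.2 (show (1:ℝ) ∈ Set.Ioi 0 by simp)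
      (show (2:ℝ) ∈ Set.Ioi 0 by simp) (show (0:ℝ) ≤ 1 - 1/p by linarith) h0p (by ring)
    simp only [smul_eq_mul, Real.Gamma_one, Real.Gamma_two] at this
    have e : (1 - 1/p) * 1 + 1/p * 2 = 1/p + 1 := by ring
    rw [e] at this
    linarith
  have hintegrable : IntegrableOn (fun x : ℝ => Real.exp (-K * x ^ p)) (Set.Ioi 0) := by
    by_contra hc
    rw [integral_undef hc] at hint
    have : 0 < K ^ (-1/p) * Real.Gamma (1/p + 1) := by positivity
    linarith
  have hlint : ∫⁻ s in Set.Ioi (0:ℝ), ENNReal.ofReal (Real.exp (-K * s ^ p)) ≤ ENNReal.ofReal b := by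
    rw [← ofReal_integral_eq_lintegral_ofReal hintegrable
      (Filter.Eventually.of_forall fun _ => (Real.exp_pos _).le), hint]
    apply ENNReal.ofReal_le_ofReal
    rw [← hb]; nlinarith
  have hshift : ∫⁻ s in Set.Ioi r₀, ENNReal.ofReal (Real.exp (-K * (s - r₀) ^ p))
      = ∫⁻ s in Set.Ioi (0:ℝ), ENNReal.ofReal (Real.exp (-K * s ^ p)) := by
    rw [← lintegral_indicator measurableSet_Ioi, ← lintegral_indicator measurableSet_Ioi]
    rw [← lintegral_sub_right_eq_self
      ((Set.Ioi (0:ℝ)).indicator fun s => ENNReal.ofReal (Real.exp (-K * s ^ p))) r₀]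
    congr 1; ext s
    simp [Set.indicator]
  -- layer cake
  have hYi : Integrable (fun x => max (m + t - X x) 0) μ :=
    ((integrable_const _).sub hi).sup (integrable_const 0)
  have layer : ENNReal.ofReal t ≤ ENNReal.ofReal (r₀ + b) := by
    have e1 : t ≤ ∫ x, max (m + t - X x) 0 ∂μ := by
      have : ∫ x, (m + t - X x) ∂μ = t := by
        rw [integral_sub (integrable_const _) hi]; simp [← hm]
      conv_lhs => rw [← this]
      exact integral_mono ((integrable_const _).sub hi) hYi fun x => le_max_left _ _
    refine (ENNReal.ofReal_le_ofReal e1).trans ?_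
    rw [ofReal_integral_eq_lintegral_ofReal hYi (.of_forall fun x => le_max_right _ _),
      lintegral_eq_lintegral_meas_le (f := fun x => max (m + t - X x) 0) μ
        (.of_forall fun x => le_max_right _ _) hYi.aestronglyMeasurable.aemeasurable,
      ← Set.Ioc_union_Ioi_eq_Ioi r0]
    refine (lintegral_union_le _ _ _).trans ?_
    rw [ENNReal.ofReal_add r0 b0.le]
    refine add_le_add ?_ ?_
    · calc ∫⁻ s in Set.Ioc 0 r₀, μ {x | s ≤ max (m + t - X x) 0}
          ≤ ∫⁻ s in Set.Ioc 0 r₀, 1 := lintegral_mono fun s => prob_le_one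
        _ = ENNReal.ofReal r₀ := by simp
    · refine le_trans ?_ (hshift.le.trans hlint)
      refine setLIntegral_mono' measurableSet_Ioi fun s hs => ?_
      have hs : r₀ < s := hs
      refine le_trans (measure_mono fun x hx => ?_) (tail s hs.le)
      have hx : s ≤ max (m + t - X x) 0 := hx
      rcases le_max_iff.1 hx with h | h
      · show X x ≤ m + t - s
        linarith
      · linarith
  have hfin : t ≤ r₀ + b := by
    rwa [ENNReal.ofReal_le_ofReal_iff (by positivity)] at layer
  apply ENNReal.ofReal_le_ofReal
  rw [hae]
  apply Real.exp_le_exp.2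
  have : (t - b) ^ p ≤ r₀ ^ p := Real.rpow_le_rpow (by linarith) (by linarith) (by linarith)
  nlinarith

/-- Numerical comparison of the exponents. -/
lemma exponent_compare (p : ℝ) (hp : 2 ≤ p) (K : ℝ) (hK : 0 < K) (M : ℝ)
    (hM : M = 2 * (3 ^ (p - 1) * (p - 1) ^ (p - 1))) (t : ℝ) (ht : 0 ≤ t)
    (hbig : Real.log 2 < K / M * t ^ p) :
    K ^ (-1/p) ≤ t ∧ K / M * t ^ p ≤ K * (t - K ^ (-1/p)) ^ p := by
  have p0 : p ≠ 0 := by linarith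
  have hM94 : (9/4 : ℝ) ^ p ≤ M := by
    have h1 : (1:ℝ) ≤ (p - 1) ^ (p - 1) := Real.one_le_rpow (by linarith) (by linarith)
    have h2 : (9/4 : ℝ) ^ (p - 2) ≤ 3 ^ (p - 2) :=
      Real.rpow_le_rpow (by norm_num) (by norm_num) (by linarith)
    have h3 : (9/4 : ℝ) ^ p = (9/4) ^ (p - 2) * (9/4) ^ 2 := by
      rw [← Real.rpow_natCast, ← Real.rpow_add (by norm_num)]; congr 1; push_cast; ring
    have h4 : (3 : ℝ) ^ (p - 1) = 3 ^ (p - 2) * 3 := by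
      conv_rhs => rw [← Real.rpow_one 3, ← Real.rpow_mul (by norm_num), one_mul]
      rw [← Real.rpow_add (by norm_num)]; congr 1; ring
    have h5 : (0:ℝ) < 3 ^ (p - 2) := by positivity
    rw [hM, h4, h3]
    nlinarith [mul_le_mul_of_nonneg_left h1 h5.le]
  have M0 : 0 < M := lt_of_lt_of_le (by positivity) hM94
  set L := M ^ (1/p) with hL
  have LM : L ^ p = M := by
    rw [hL, ← Real.rpow_mul M0.le, one_div, inv_mul_cancel₀ p0, Real.rpow_one]
  have L94 : 9/4 ≤ L := by
    have := Real.rpow_le_rpow (by positivity) hM94 (z := 1/p) (by positivity)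
    rwa [← Real.rpow_mul (by norm_num), mul_one_div_cancel p0, Real.rpow_one] at this
  set b := K ^ (-1/p) with hb
  have b0 : 0 < b := Real.rpow_pos_of_pos hK _
  have Kb : K * b ^ p = 1 := by
    rw [hb, ← Real.rpow_mul hK.le, div_mul_cancel₀ _ p0, Real.rpow_neg_one, mul_inv_cancel₀ hK.ne']
  have L0 : 0 < L := by linarith
  -- `τ = t / b`
  obtain ⟨τ, rfl⟩ : ∃ τ, t = b * τ := ⟨t / b, by field_simp⟩
  have τ0 : 0 ≤ τ := by
    by_contra hc; push Not at hc; nlinarith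
  have e1 : K / M * (b * τ) ^ p = (τ / L) ^ p := by
    rw [Real.mul_rpow b0.le τ0, Real.div_rpow τ0 L0.le, LM]
    calc K / M * (b ^ p * τ ^ p) = (K * b ^ p) * τ ^ p / M := by ring
      _ = _ := by rw [Kb, one_mul]
  rw [e1] at hbig ⊢
  have h83 : 83/100 < τ / L := by
    by_contra hc
    push Not at hc
    have h1 : (τ / L) ^ p ≤ (83/100) ^ p := Real.rpow_le_rpow (by positivity) hc (by linarith)
    have h2 : (83/100 : ℝ) ^ p ≤ (83/100) ^ (2:ℝ) :=
      Real.rpow_le_rpow_of_exponent_ge (by norm_num) (by norm_num) hp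
    have h3 : (83/100 : ℝ) ^ (2:ℝ) = 6889/10000 := by
      rw [show (2:ℝ) = ((2:ℕ):ℝ) by norm_num, Real.rpow_natCast]; norm_num
    have := Real.log_two_gt_d9
    rw [h3] at h2
    linarith
  set σ := τ / L with hσ
  have hτ : τ = σ * L := by rw [hσ]; field_simp
  have h1 : σ ≤ τ - 1 := by rw [hτ]; nlinarith
  refine ⟨by nlinarith, ?_⟩
  have e2 : K * (b * τ - b) ^ p = (τ - 1) ^ p := by
    rw [show b * τ - b = b * (τ - 1) by ring, Real.mul_rpow b0.le (by linarith), ← mul_assoc, Kb,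
      one_mul]
  rw [e2]
  exact Real.rpow_le_rpow (by linarith) h1 (by linarith)

lemma lip_cont {p : ℝ} (hp : 2 ≤ p) {n : ℕ} (f : (Fin n → ℝ) → ℝ)
    (hf : ∀ x y : Fin n → ℝ, |f x - f y| ≤ lpNorm p (x - y)) : Continuous f := by
  rw [continuous_iff_continuousAt]
  intro x
  rw [ContinuousAt, tendsto_iff_dist_tendsto_zero]
  refine squeeze_zero (fun _ => dist_nonneg) (fun y => (Real.dist_eq _ _).le.trans (hf y x)) ?_
  have h : Continuous fun y => lpNorm p (y - x) := (lpn_cont hp).comp (continuous_id.sub continuous_const)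
  have := h.tendsto x
  simp only [sub_self, lpn_zero hp] at this
  exact this

lemma one_sided (p : ℝ) (hp : 2 ≤ p) (n : ℕ) (hn : 3 ≤ n)
    (f : (Fin n → ℝ) → ℝ) (hf : ∀ x y : Fin n → ℝ, |f x - f y| ≤ lpNorm p (x - y))
    (t : ℝ) (K : ℝ) (hK : K = 2 * n / (p * 4 ^ p)) (ht : K ^ (-1/p) ≤ t) :
    Integrable f (coneMeasure p n) ∧
    coneMeasure p n {x | (∫ y, f y ∂(coneMeasure p n)) + t ≤ f x} ≤
      ENNReal.ofReal (Real.exp (-K * (t - K ^ (-1/p)) ^ p)) := by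
  have := cone_prob (p := p) hp hn
  have fm := (lip_cont hp f hf).measurable
  have hi : Integrable f (coneMeasure p n) := by
    refine Integrable.of_bound fm.aestronglyMeasurable (|f 0| + 1) ?_
    filter_upwards [cone_ae (n := n) hp] with x hx
    have := hf x 0
    rw [sub_zero] at this
    have h2 := abs_sub_abs_le_abs_sub (f x) (f 0)
    rw [Real.norm_eq_abs]
    linarith
  refine ⟨hi, mean_tail _ f fm hi p K hp ?_ ?_ t ht⟩
  · have : (0:ℝ) < n := by exact_mod_cast (by omega : 0 < n)
    rw [hK]; positivity
  · intro u r hr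
    rw [hK]
    refine cone_sep hp hn _ _ (measurableSet_le measurable_const fm)
      (measurableSet_le fm measurable_const) r hr ?_
    intro a ha b hb
    have ha : u ≤ f a := ha
    have hb : f b ≤ u - r := hb
    have := (le_abs_self _).trans (hf a b)
    linarith

/-- First order concentration for the cone measure on the `ℓ_p`-sphere (equation (4.4)):
if `f` is `1`-Lipschitz with respect to the `ℓ_p`-norm, then
`μ_{p,n}(|f - ∫ f dμ_{p,n}| ≥ t) ≤ 2 exp(-((q-1)^p/(3^{p-1} 4^p q)) n t^p)`. -/
theorem lipschitz_concentration_cone (p : ℝ) (hp : 2 ≤ p) (q : ℝ) (hq : q = p / (p - 1))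
    (n : ℕ) (hn : 3 ≤ n)
    (f : (Fin n → ℝ) → ℝ) (hf : ∀ x y : Fin n → ℝ, |f x - f y| ≤ lpNorm p (x - y))
    (t : ℝ) (ht : 0 ≤ t) :
    coneMeasure p n {x | t ≤ |f x - ∫ y, f y ∂(coneMeasure p n)|} ≤
      ENNReal.ofReal (2 * Real.exp
        (-((q - 1) ^ p / (3 ^ (p - 1) * 4 ^ p * q)) * n * t ^ p)) := by
  have := cone_prob (p := p) hp hn
  have n0 : (0:ℝ) < n := by exact_mod_cast (by omega : 0 < n)
  have p1 : 0 < p - 1 := by linarith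
  set K : ℝ := 2 * n / (p * 4 ^ p) with hK
  set M : ℝ := 2 * (3 ^ (p - 1) * (p - 1) ^ (p - 1)) with hM
  have K0 : 0 < K := by positivity
  have hc : -((q - 1) ^ p / (3 ^ (p - 1) * 4 ^ p * q)) * n * t ^ p = -(K / M * t ^ p) := by
    have hq1 : q - 1 = (p - 1)⁻¹ := by rw [hq]; field_simp; ring
    have hpp : (p - 1) ^ p = (p - 1) ^ (p - 1) * (p - 1) := by
      conv_rhs => rw [← Real.rpow_add_one p1.ne', sub_add_cancel]
    rw [hq1, Real.inv_rpow p1.le, hpp, hq, hK, hM]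
    have a1 : (p - 1) ^ (p - 1) ≠ 0 := by positivity
    have a2 : (3:ℝ) ^ (p - 1) ≠ 0 := by positivity
    have a3 : (4:ℝ) ^ p ≠ 0 := by positivity
    have a4 : p ≠ 0 := by linarith
    have a5 : p - 1 ≠ 0 := p1.ne'
    generalize (p - 1) ^ (p - 1) = w at *
    generalize (3:ℝ) ^ (p - 1) = w2 at *
    generalize (4:ℝ) ^ p = w3 at *
    generalize t ^ p = w4 at *
    field_simp
  rw [hc]
  by_cases hbig : K / M * t ^ p ≤ Real.log 2
  · refine prob_le_one.trans ?_
    rw [← ENNReal.ofReal_one]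
    apply ENNReal.ofReal_le_ofReal
    have : Real.exp (-Real.log 2) ≤ Real.exp (-(K / M * t ^ p)) := Real.exp_le_exp.2 (by linarith)
    rw [Real.exp_neg, Real.exp_log (by norm_num)] at this
    linarith
  push Not at hbig
  obtain ⟨hb, hcmp⟩ := exponent_compare p hp K K0 M hM t ht hbig
  obtain ⟨hi, h1⟩ := one_sided p hp n hn f hf t K hK hb
  obtain ⟨-, h2⟩ := one_sided p hp n hn (fun x => - f x) (fun x y => by
    have := hf y x
    rw [lpn_sub_comm hp] at this
    rw [neg_sub_neg]; exact this) t K hK hb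
  rw [integral_neg] at h2
  set m := ∫ y, f y ∂(coneMeasure p n) with hm
  have hexp : Real.exp (-K * (t - K ^ (-1/p)) ^ p) ≤ Real.exp (-(K / M * t ^ p)) :=
    Real.exp_le_exp.2 (by linarith)
  calc coneMeasure p n {x | t ≤ |f x - m|}
      ≤ coneMeasure p n ({x | m + t ≤ f x} ∪ {x | -m + t ≤ -f x}) := by
        refine measure_mono fun x hx => ?_
        have hx : t ≤ |f x - m| := hx
        rcases le_abs.1 hx with h | h
        · left; show m + t ≤ f x; linarith
        · right; show -m + t ≤ -f x; linarith
    _ ≤ _ := measure_union_le _ _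
    _ ≤ ENNReal.ofReal (Real.exp (-(K / M * t ^ p))) + ENNReal.ofReal (Real.exp (-(K / M * t ^ p))) :=
        add_le_add (h1.trans (ENNReal.ofReal_le_ofReal hexp))
          (h2.trans (ENNReal.ofReal_le_ofReal hexp))
    _ = _ := by
      rw [← ENNReal.ofReal_add (Real.exp_pos _).le (Real.exp_pos _).le]; congr 1; ring
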